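/- There exist constants B, C ∈ (0,∞) (depending on n, m, the matrices Λ^{(k)} and the parameter a) such that for every (x,z) ∈ ℝ^{n+m} with (x,z) ≠ 0: |ΔN| ≤ B·|x|²/N³, and |X_iX_jN| ≤ (C/N)(1 + |∇N|²) for all i, j ∈ {1,…,n}. -/

import Mathlib

open Real MeasureTheory Filter

/-- A point of the type-2 Carnot group `ℝ^{n+m}`. -/
abbrev Pt (n m : ℕ) := (Fin n → ℝ) × (Fin m → ℝ)

/-- The horizontal vector field
`X_i = ∂/∂x_i + (1/2) Σ_k Σ_l Λ^{(k)}_{il} x_l ∂/∂z_k` on the type-2 Carnot group. -/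
noncomputable def X {n m : ℕ} (Λ : Fin m → Fin n → Fin n → ℝ) (i : Fin n)
    (f : Pt n m → ℝ) (p : Pt n m) : ℝ :=
  fderiv ℝ f p (Pi.single i 1, 0) +
    (1 / 2) * ∑ k : Fin m, ∑ l : Fin n,
      Λ k i l * p.1 l * fderiv ℝ f p (0, Pi.single k 1)

/-- The squared length of the sub-gradient, `|∇f|² = Σ_i (X_i f)²`. -/
noncomputable def gradSq {n m : ℕ} (Λ : Fin m → Fin n → Fin n → ℝ)
    (f : Pt n m → ℝ) (p : Pt n m) : ℝ :=
  ∑ i : Fin n, (X Λ i f p) ^ 2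

/-- The sub-Laplacian `Δf = Σ_i X_i² f`. -/
noncomputable def subLap {n m : ℕ} (Λ : Fin m → Fin n → Fin n → ℝ)
    (f : Pt n m → ℝ) (p : Pt n m) : ℝ :=
  ∑ i : Fin n, X Λ i (X Λ i f) p

/-- The smooth homogeneous norm `N(x,z) = (|x|⁴ + a|z|²)^(1/4)`. -/
noncomputable def Nrm {n m : ℕ} (a : ℝ) (p : Pt n m) : ℝ :=
  ((∑ i, p.1 i ^ 2) ^ 2 + a * ∑ j, p.2 j ^ 2) ^ ((1 : ℝ) / 4)

/-- Euclidean length of the horizontal component `x` of a point. -/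
noncomputable def xnorm {n m : ℕ} (p : Pt n m) : ℝ :=
  Real.sqrt (∑ i, p.1 i ^ 2)

/-- The normalized Gibbs measure `Z⁻¹ e^{−U} dλ`. -/
noncomputable def gibbsP {E : Type*} [MeasureSpace E] (U : E → ℝ) : Measure E :=
  (ENNReal.ofReal (∫ p, Real.exp (-(U p))))⁻¹ •
    (volume.withDensity fun p => ENNReal.ofReal (Real.exp (-(U p))))


theorem abs_sub_add_bound (a b : ℝ) : |a - b| ≤ |a| + |b| := norm_sub_le a b

/-- directional derivative predicate -/
def HX {n m : ℕ} (v : Pt n m) (f : Pt n m → ℝ) (p : Pt n m) (d : ℝ) : Prop :=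
  ∃ f' : Pt n m →L[ℝ] ℝ, HasFDerivAt f f' p ∧ f' v = d

/-- the direction of `X_i` at `p` -/
noncomputable def vec {n m : ℕ} (Λ : Fin m → Fin n → Fin n → ℝ) (i : Fin n) (p : Pt n m) :
    Pt n m :=
  (Pi.single i 1, fun k => (1 / 2) * ∑ l, Λ k i l * p.1 l)

theorem HX.X_eq {n m : ℕ} {Λ : Fin m → Fin n → Fin n → ℝ} {i : Fin n} {p : Pt n m}
    {f : Pt n m → ℝ} {d : ℝ} (h : HX (vec Λ i p) f p d) : X Λ i f p = d := by
  obtain ⟨f', hf, rfl⟩ := h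
  have e : vec Λ i p = (Pi.single i 1, 0) +
      ∑ k, ((1 / 2) * ∑ l, Λ k i l * p.1 l) • ((0, Pi.single k 1) : Pt n m) := by
    refine Prod.ext ?_ ?_
    · simp [vec, Prod.fst_sum]
    · funext k
      simp [vec, Prod.snd_sum, Finset.sum_apply, Pi.single_apply]
  rw [e, map_add, map_sum]
  simp only [map_smul, smul_eq_mul, X, hf.fderiv, Finset.mul_sum, Finset.sum_mul]
  simp only [mul_assoc]

theorem X_congr {n m : ℕ} {Λ : Fin m → Fin n → Fin n → ℝ} {i : Fin n} {p : Pt n m}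
    {f g : Pt n m → ℝ} (h : f =ᶠ[nhds p] g) : X Λ i f p = X Λ i g p := by
  simp only [X, h.fderiv_eq]

section
variable {n m : ℕ} {v p : Pt n m} {f g : Pt n m → ℝ} {d e : ℝ}

theorem HX.cast (h : HX v f p d) (he : d = e) : HX v f p e := he ▸ h

theorem HX.add (hf : HX v f p d) (hg : HX v g p e) : HX v (fun q => f q + g q) p (d + e) := by
  obtain ⟨f', hf, rfl⟩ := hf
  obtain ⟨g', hg, rfl⟩ := hg
  exact ⟨_, hf.add hg, rfl⟩

theorem HX.mul (hf : HX v f p d) (hg : HX v g p e) :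
    HX v (fun q => f q * g q) p (d * g p + f p * e) := by
  obtain ⟨f', hf, rfl⟩ := hf
  obtain ⟨g', hg, rfl⟩ := hg
  refine ⟨_, hf.mul hg, ?_⟩
  simp
  ring

theorem HX.const (c : ℝ) : HX v (fun _ => c) p 0 := ⟨_, hasFDerivAt_const c p, rfl⟩

theorem HX.sum {ι : Type*} {s : Finset ι} {f : ι → Pt n m → ℝ} {d : ι → ℝ}
    (h : ∀ i, HX v (f i) p (d i)) : HX v (fun q => ∑ i ∈ s, f i q) p (∑ i ∈ s, d i) := by
  choose f' h1 h2 using h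
  refine ⟨∑ i ∈ s, f' i, HasFDerivAt.fun_sum fun i _ => h1 i, ?_⟩
  simp [h2]

theorem HX.comp {φ : ℝ → ℝ} {c : ℝ} (hf : HX v f p d) (hφ : HasDerivAt φ c (f p)) :
    HX v (fun q => φ (f q)) p (c * d) := by
  obtain ⟨f', hf, rfl⟩ := hf
  exact ⟨_, hφ.comp_hasFDerivAt p hf, rfl⟩

theorem HX.x (l : Fin n) : HX v (fun q => q.1 l) p (v.1 l) :=
  ⟨(ContinuousLinearMap.proj l).comp (ContinuousLinearMap.fst ℝ _ _),
    ((ContinuousLinearMap.proj l).comp (ContinuousLinearMap.fst ℝ (Fin n → ℝ) (Fin m → ℝ)) : Pt n m →L[ℝ] ℝ).hasFDerivAt, rfl⟩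

theorem HX.z (l : Fin m) : HX v (fun q => q.2 l) p (v.2 l) :=
  ⟨(ContinuousLinearMap.proj l).comp (ContinuousLinearMap.snd ℝ _ _),
    ((ContinuousLinearMap.proj l).comp (ContinuousLinearMap.snd ℝ (Fin n → ℝ) (Fin m → ℝ)) : Pt n m →L[ℝ] ℝ).hasFDerivAt, rfl⟩

theorem HX.sq (hf : HX v f p d) : HX v (fun q => f q ^ 2) p (2 * f p * d) := by
  have := hf.comp (hasDerivAt_pow 2 (f p))
  exact this.cast (by simp)

end

section
variable {n m : ℕ} (Λ : Fin m → Fin n → Fin n → ℝ) (a : ℝ)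

/-- `N^4` -/
noncomputable def FF (p : Pt n m) : ℝ := (∑ i, p.1 i ^ 2) ^ 2 + a * ∑ j, p.2 j ^ 2

/-- `(Λ^k x)_j` -/
noncomputable def Lx (k : Fin m) (j : Fin n) (p : Pt n m) : ℝ := ∑ l, Λ k j l * p.1 l

/-- `X_j N^4` -/
noncomputable def GG (j : Fin n) (p : Pt n m) : ℝ :=
  4 * (∑ i, p.1 i ^ 2) * p.1 j + a * ∑ k, Lx Λ k j p * p.2 k

/-- `X_i X_j N^4` -/
noncomputable def HH (i j : Fin n) (p : Pt n m) : ℝ :=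
  8 * p.1 i * p.1 j + 4 * (∑ i, p.1 i ^ 2) * (if i = j then 1 else 0)
    + a * ∑ k, (Λ k j i * p.2 k + (1 / 2) * Lx Λ k j p * Lx Λ k i p)

theorem HX_r (i : Fin n) (p : Pt n m) :
    HX (vec Λ i p) (fun q => ∑ i, q.1 i ^ 2) p (2 * p.1 i) := by
  refine (HX.sum fun l => (HX.x l).sq).cast ?_
  simp [vec, Pi.single_apply]

theorem HX_F (i : Fin n) (p : Pt n m) : HX (vec Λ i p) (FF a) p (GG Λ a i p) := by
  refine ((HX_r Λ i p).sq.add ((HX.const a).mul (HX.sum fun l => (HX.z l).sq))).cast ?_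
  have : ∀ k, 2 * p.2 k * (vec Λ i p).2 k = Lx Λ k i p * p.2 k := by
    intro k
    simp only [vec, Lx]
    ring
  simp only [this, GG]
  ring

theorem HX_L (k : Fin m) (i j : Fin n) (p : Pt n m) :
    HX (vec Λ i p) (Lx Λ k j) p (Λ k j i) := by
  refine (HX.sum fun l => (HX.const (Λ k j l)).mul (HX.x l)).cast ?_
  simp [vec, Pi.single_apply]

theorem HX_G (i j : Fin n) (p : Pt n m) : HX (vec Λ i p) (GG Λ a j) p (HH Λ a i j p) := by
  refine ((((HX.const 4).mul (HX_r Λ i p)).mul (HX.x j)).add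
    ((HX.const a).mul (HX.sum fun k => (HX_L Λ k i j p).mul (HX.z k)))).cast ?_
  have : ∀ k, Λ k j i * p.2 k + Lx Λ k j p * (vec Λ i p).2 k
      = Λ k j i * p.2 k + (1 / 2) * Lx Λ k j p * Lx Λ k i p := by
    intro k
    simp only [vec, Lx]
    ring
  have h2 : (vec Λ i p).1 j = if i = j then 1 else 0 := by
    simp [vec, Pi.single_apply, eq_comm]
  simp only [this, HH, h2]
  ring

variable {a}

theorem FF_pos (ha : 0 < a) {p : Pt n m} (hp : p ≠ 0) : 0 < FF a p := by
  by_contra hcon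
  have h1 : 0 ≤ ∑ i, p.1 i ^ 2 := Finset.sum_nonneg fun i _ => sq_nonneg _
  have h2 : 0 ≤ ∑ i, p.2 i ^ 2 := Finset.sum_nonneg fun i _ => sq_nonneg _
  have h3 := mul_nonneg ha.le h2
  have h4 := sq_nonneg (∑ i, p.1 i ^ 2)
  unfold FF at hcon
  have h5 : (∑ i, p.1 i ^ 2) ^ 2 = 0 := by linarith
  have h6 : a * ∑ i, p.2 i ^ 2 = 0 := by linarith
  have h7 : ∑ i, p.1 i ^ 2 = 0 := by simpa using h5
  have h8 : ∑ i, p.2 i ^ 2 = 0 := by simpa [ha.ne'] using h6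
  rw [Finset.sum_eq_zero_iff_of_nonneg fun i _ => sq_nonneg _] at h7 h8
  apply hp
  refine Prod.ext ?_ ?_
  · funext i
    simpa using h7 i (Finset.mem_univ i)
  · funext i
    simpa using h8 i (Finset.mem_univ i)

theorem N_pos (ha : 0 < a) {p : Pt n m} (hp : p ≠ 0) : 0 < Nrm a p :=
  Real.rpow_pos_of_pos (FF_pos ha hp) _

theorem N_pow (ha : 0 < a) {p : Pt n m} (hp : p ≠ 0) : Nrm a p ^ 4 = FF a p := by
  change (FF a p ^ ((1 : ℝ) / 4)) ^ 4 = _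
  rw [← Real.rpow_natCast, ← Real.rpow_mul (FF_pos ha hp).le]
  norm_num

theorem HX_N (ha : 0 < a) (i : Fin n) {p : Pt n m} (hp : p ≠ 0) :
    HX (vec Λ i p) (Nrm a) p (GG Λ a i p / (4 * Nrm a p ^ 3)) := by
  have hF := FF_pos ha hp
  have hN := N_pos ha hp
  refine ((HX_F Λ a i p).comp (φ := fun t => t ^ ((1 : ℝ) / 4))
    (Real.hasDerivAt_rpow_const (Or.inl hF.ne'))).cast ?_
  rw [Real.rpow_sub hF, Real.rpow_one]
  change 1 / 4 * (Nrm a p / FF a p) * _ = _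
  rw [← N_pow ha hp]
  field_simp

theorem X_N (ha : 0 < a) (i : Fin n) {p : Pt n m} (hp : p ≠ 0) :
    X Λ i (Nrm a) p = GG Λ a i p * (4 * Nrm a p ^ 3)⁻¹ := by
  rw [(HX_N Λ ha i hp).X_eq, div_eq_mul_inv]

theorem XX_N (ha : 0 < a) (i j : Fin n) {p : Pt n m} (hp : p ≠ 0) :
    X Λ i (X Λ j (Nrm a)) p = HH Λ a i j p / (4 * Nrm a p ^ 3)
      - 3 * (GG Λ a i p * GG Λ a j p) / (16 * Nrm a p ^ 7) := by
  have hN := N_pos ha hp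
  have ev : X Λ j (Nrm a) =ᶠ[nhds p] fun q => GG Λ a j q * (4 * Nrm a q ^ 3)⁻¹ := by
    filter_upwards [isOpen_ne.mem_nhds hp] with q hq
    exact X_N Λ ha j hq
  rw [X_congr ev]
  have hd := (((hasDerivAt_pow 3 (Nrm a p)).const_mul 4).inv (by positivity))
  rw [((HX_G Λ a i j p).mul ((HX_N Λ ha i hp).comp (φ := fun t => (4 * t ^ 3)⁻¹) hd)).X_eq]
  field_simp
  push_cast
  ring

theorem bounds (ha : 0 < a) : ∃ K1 > (0 : ℝ), ∃ K2 > (0 : ℝ), ∃ K3 > (0 : ℝ),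
    ∀ p : Pt n m, p ≠ 0 →
      (∀ i, |GG Λ a i p| ≤ K1 * (xnorm p * Nrm a p ^ 2)) ∧
      (∀ i j, |HH Λ a i j p - a * ∑ k, Λ k j i * p.2 k| ≤ K2 * xnorm p ^ 2) ∧
      (∀ i j, |a * ∑ k, Λ k j i * p.2 k| ≤ K3 * Nrm a p ^ 2) := by
  set L : ℝ := ∑ k, ∑ i, ∑ l, |Λ k i l| with hL
  have hL0 : 0 ≤ L := by positivity
  have hΛ : ∀ k i l, |Λ k i l| ≤ L := by
    intro k i l
    calc |Λ k i l| ≤ ∑ l, |Λ k i l| :=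
          Finset.single_le_sum (f := fun l => |Λ k i l|) (fun _ _ => abs_nonneg _)
            (Finset.mem_univ l)
      _ ≤ ∑ i, ∑ l, |Λ k i l| :=
          Finset.single_le_sum (f := fun i => ∑ l, |Λ k i l|) (fun _ _ => by positivity)
            (Finset.mem_univ i)
      _ ≤ L :=
          Finset.single_le_sum (f := fun k => ∑ i, ∑ l, |Λ k i l|) (fun _ _ => by positivity)
            (Finset.mem_univ k)
  refine ⟨4 + m * ((n * L) * √a), by positivity, 12 + a * (m * ((1 / 2) * (n * L) * (n * L))),
    by positivity, m * (L * √a) + 1, by positivity, ?_⟩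
  intro p hp
  have hN := N_pos ha hp
  have hN4 := N_pow ha hp
  have hs0 : 0 ≤ xnorm p := Real.sqrt_nonneg _
  have hr : ∑ i, p.1 i ^ 2 = xnorm p ^ 2 :=
    (Real.sq_sqrt (Finset.sum_nonneg fun i _ => sq_nonneg _)).symm
  have hx : ∀ i, |p.1 i| ≤ xnorm p := by
    intro i
    apply Real.abs_le_sqrt
    exact Finset.single_le_sum (f := fun i => p.1 i ^ 2) (fun _ _ => sq_nonneg _)
      (Finset.mem_univ i)
  have hz2 : 0 ≤ ∑ i, p.2 i ^ 2 := Finset.sum_nonneg fun i _ => sq_nonneg _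
  have hsw : xnorm p ^ 2 ≤ Nrm a p ^ 2 := by
    refine (pow_le_pow_iff_left₀ (by positivity) (by positivity) two_ne_zero).mp ?_
    have : (Nrm a p ^ 2) ^ 2 = FF a p := by rw [← hN4]; ring
    rw [this, FF, hr]
    have := mul_nonneg ha.le hz2
    linarith
  have hz : ∀ k, a * |p.2 k| ≤ √a * Nrm a p ^ 2 := by
    intro k
    have h1 : √a * |p.2 k| ≤ Nrm a p ^ 2 := by
      refine (pow_le_pow_iff_left₀ (by positivity) (by positivity) two_ne_zero).mp ?_
      have e : (Nrm a p ^ 2) ^ 2 = FF a p := by rw [← hN4]; ring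
      rw [e, FF, mul_pow, Real.sq_sqrt ha.le, sq_abs]
      have := mul_le_mul_of_nonneg_left (Finset.single_le_sum (f := fun i => p.2 i ^ 2)
        (fun _ _ => sq_nonneg _) (Finset.mem_univ k)) ha.le
      have := sq_nonneg (∑ i, p.1 i ^ 2)
      linarith
    calc a * |p.2 k| = √a * (√a * |p.2 k|) := by
          rw [← mul_assoc, Real.mul_self_sqrt ha.le]
      _ ≤ _ := by gcongr
  have hLx : ∀ k j, |Lx Λ k j p| ≤ n * L * xnorm p := by
    intro k j
    calc |Lx Λ k j p| ≤ ∑ l, |Λ k j l * p.1 l| := Finset.abs_sum_le_sum_abs _ _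
      _ ≤ ∑ l : Fin n, L * xnorm p := by
          apply Finset.sum_le_sum
          intro l _
          rw [abs_mul]
          exact mul_le_mul (hΛ k j l) (hx l) (abs_nonneg _) hL0
      _ = _ := by simp; ring
  refine ⟨?_, ?_, ?_⟩
  · intro i
    have h1 : |4 * (∑ i, p.1 i ^ 2) * p.1 i| ≤ 4 * (xnorm p * Nrm a p ^ 2) := by
      rw [hr, abs_mul, abs_of_nonneg (by positivity)]
      calc 4 * xnorm p ^ 2 * |p.1 i| ≤ 4 * Nrm a p ^ 2 * xnorm p := by
            gcongr
            exact hx i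
        _ = _ := by ring
    have h2 : |a * ∑ k, Lx Λ k i p * p.2 k|
        ≤ m * ((n * L) * √a) * (xnorm p * Nrm a p ^ 2) := by
      rw [Finset.mul_sum]
      calc |∑ k, a * (Lx Λ k i p * p.2 k)| ≤ ∑ k, |a * (Lx Λ k i p * p.2 k)| :=
            Finset.abs_sum_le_sum_abs _ _
        _ ≤ ∑ k : Fin m, (n * L * xnorm p) * (√a * Nrm a p ^ 2) := by
            apply Finset.sum_le_sum
            intro k _
            rw [abs_mul, abs_mul, abs_of_pos ha, mul_left_comm]
            exact mul_le_mul (hLx k i) (hz k) (by positivity) (by positivity)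
        _ = _ := by simp; ring
    calc _ ≤ _ := abs_add_le _ _
      _ ≤ _ := add_le_add h1 h2
      _ = _ := by ring
  · intro i j
    have e : HH Λ a i j p - a * ∑ k, Λ k j i * p.2 k = 8 * p.1 i * p.1 j
        + 4 * (∑ i, p.1 i ^ 2) * (if i = j then 1 else 0)
        + a * ∑ k, (1 / 2) * Lx Λ k j p * Lx Λ k i p := by
      rw [HH, Finset.sum_add_distrib]
      ring
    rw [e, hr]
    have h1 : |8 * p.1 i * p.1 j| ≤ 8 * xnorm p ^ 2 := by
      rw [abs_mul, abs_mul, abs_of_pos (by norm_num : (0 : ℝ) < 8)]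
      calc 8 * |p.1 i| * |p.1 j| ≤ 8 * xnorm p * xnorm p := by
            gcongr
            · exact hx i
            · exact hx j
        _ = _ := by ring
    have h2 : |4 * xnorm p ^ 2 * (if i = j then 1 else 0)| ≤ 4 * xnorm p ^ 2 := by
      split_ifs
      · rw [mul_one, abs_of_nonneg (by positivity)]
      · simp
        positivity
    have h3 : |a * ∑ k, (1 / 2) * Lx Λ k j p * Lx Λ k i p|
        ≤ a * (m * ((1 / 2) * (n * L) * (n * L))) * xnorm p ^ 2 := by
      rw [abs_mul, abs_of_pos ha]
      calc a * |∑ k, (1 / 2) * Lx Λ k j p * Lx Λ k i p|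
          ≤ a * ∑ k, |(1 / 2) * Lx Λ k j p * Lx Λ k i p| := by
            gcongr
            exact Finset.abs_sum_le_sum_abs _ _
        _ ≤ a * ∑ k : Fin m, (1 / 2) * (n * L * xnorm p) * (n * L * xnorm p) := by
            gcongr with k
            rw [abs_mul, abs_mul, abs_of_pos (by norm_num : (0 : ℝ) < 1 / 2)]
            gcongr
            · exact hLx k j
            · exact hLx k i
        _ = _ := by simp; ring
    calc _ ≤ _ := abs_add_three _ _ _
      _ ≤ _ := add_le_add (add_le_add h1 h2) h3
      _ = _ := by ring
  · intro i j
    rw [Finset.mul_sum]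
    calc |∑ k, a * (Λ k j i * p.2 k)| ≤ ∑ k, |a * (Λ k j i * p.2 k)| :=
          Finset.abs_sum_le_sum_abs _ _
      _ ≤ ∑ k : Fin m, L * (√a * Nrm a p ^ 2) := by
          apply Finset.sum_le_sum
          intro k _
          rw [abs_mul, abs_mul, abs_of_pos ha, mul_left_comm]
          exact mul_le_mul (hΛ k j i) (hz k) (by positivity) (by positivity)
      _ = m * (L * √a) * Nrm a p ^ 2 := by simp; ring
      _ ≤ _ := by
          gcongr
          linarith

end

theorem sublaplacian_and_second_derivative_bounds_for_smooth_norm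
    (n m : ℕ) (Λ : Fin m → Fin n → Fin n → ℝ)
    (hskew : ∀ k i l, Λ k i l = -Λ k l i) (hLI : LinearIndependent ℝ Λ)
    (a : ℝ) (ha : 0 < a) :
    ∃ B > (0 : ℝ), ∃ C > (0 : ℝ), ∀ p : Pt n m, p ≠ 0 →
      |subLap Λ (Nrm a) p| ≤ B * (∑ i, p.1 i ^ 2) / (Nrm a p) ^ 3 ∧
      ∀ i j : Fin n,
        |X Λ i (X Λ j (Nrm a)) p| ≤ (C / Nrm a p) * (1 + gradSq Λ (Nrm a) p) := by
  obtain ⟨K1, hK1, K2, hK2, K3, hK3, hb⟩ := bounds Λ ha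
  refine ⟨n * (K2 + K1 ^ 2) + 1, by positivity, K2 + K3 + K1 ^ 2, by positivity, ?_⟩
  intro p hp
  obtain ⟨hG, hH, hT⟩ := hb p hp
  have hN := N_pos ha hp
  have hN4 := N_pow ha hp
  have hs0 : 0 ≤ xnorm p := Real.sqrt_nonneg _
  have hr : ∑ i, p.1 i ^ 2 = xnorm p ^ 2 :=
    (Real.sq_sqrt (Finset.sum_nonneg fun i _ => sq_nonneg _)).symm
  have hsw : xnorm p ^ 2 ≤ Nrm a p ^ 2 := by
    refine (pow_le_pow_iff_left₀ (by positivity) (by positivity) two_ne_zero).mp ?_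
    have : (Nrm a p ^ 2) ^ 2 = FF a p := by rw [← hN4]; ring
    rw [this, FF, hr]
    have := mul_nonneg ha.le (Finset.sum_nonneg fun i (_ : i ∈ Finset.univ) => sq_nonneg (p.2 i))
    linarith
  have hGG : ∀ i j, |3 * (GG Λ a i p * GG Λ a j p) / (16 * Nrm a p ^ 7)|
      ≤ K1 ^ 2 * xnorm p ^ 2 / Nrm a p ^ 3 := by
    intro i j
    have h1 : |GG Λ a i p * GG Λ a j p| ≤ K1 ^ 2 * xnorm p ^ 2 * Nrm a p ^ 4 := by
      rw [abs_mul]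
      calc _ ≤ _ := mul_le_mul (hG i) (hG j) (abs_nonneg _) (by positivity)
        _ = _ := by ring
    rw [abs_div, abs_mul, abs_of_pos (by norm_num : (0 : ℝ) < 3),
      abs_of_pos (by positivity : 0 < 16 * Nrm a p ^ 7), div_le_div_iff₀ (by positivity)
      (by positivity)]
    have h0 : 0 ≤ K1 ^ 2 * xnorm p ^ 2 * Nrm a p ^ 7 := by positivity
    calc 3 * |GG Λ a i p * GG Λ a j p| * Nrm a p ^ 3
        ≤ 3 * (K1 ^ 2 * xnorm p ^ 2 * Nrm a p ^ 4) * Nrm a p ^ 3 := by gcongr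
      _ = 3 * (K1 ^ 2 * xnorm p ^ 2 * Nrm a p ^ 7) := by ring
      _ ≤ 16 * (K1 ^ 2 * xnorm p ^ 2 * Nrm a p ^ 7) := by linarith
      _ = _ := by ring
  have hdiv : ∀ h c : ℝ, |h| ≤ c → |h / (4 * Nrm a p ^ 3)| ≤ c / Nrm a p ^ 3 := by
    intro h c hc
    rw [abs_div, abs_of_pos (by positivity : 0 < 4 * Nrm a p ^ 3)]
    have hc0 : 0 ≤ c := (abs_nonneg h).trans hc
    have : Nrm a p ^ 3 ≤ 4 * Nrm a p ^ 3 := by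
      have : 0 < Nrm a p ^ 3 := by positivity
      linarith
    gcongr
  constructor
  · have key : ∀ i, |X Λ i (X Λ i (Nrm a)) p| ≤ (K2 + K1 ^ 2) * xnorm p ^ 2 / Nrm a p ^ 3 := by
      intro i
      rw [XX_N Λ ha i i hp]
      have hz : ∀ k, Λ k i i = 0 := by
        intro k
        have := hskew k i i
        linarith
      have h1 := hH i i
      simp only [hz, zero_mul, Finset.sum_const_zero, mul_zero, sub_zero] at h1
      calc _ ≤ _ := abs_sub_add_bound _ _
        _ ≤ _ := add_le_add (hdiv _ _ h1) (hGG i i)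
        _ = _ := by ring
    rw [hr, subLap]
    calc _ ≤ _ := Finset.abs_sum_le_sum_abs _ _
      _ ≤ ∑ i : Fin n, (K2 + K1 ^ 2) * xnorm p ^ 2 / Nrm a p ^ 3 :=
          Finset.sum_le_sum fun i _ => key i
      _ = n * (K2 + K1 ^ 2) * xnorm p ^ 2 / Nrm a p ^ 3 := by simp; ring
      _ ≤ _ := by
          gcongr
          linarith
  · intro i j
    have hg : 0 ≤ gradSq Λ (Nrm a) p := Finset.sum_nonneg fun i _ => sq_nonneg _
    rw [XX_N Λ ha i j hp]
    have h1 : |HH Λ a i j p| ≤ (K2 + K3) * Nrm a p ^ 2 := by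
      calc |HH Λ a i j p| = |(HH Λ a i j p - a * ∑ k, Λ k j i * p.2 k)
            + a * ∑ k, Λ k j i * p.2 k| := by rw [sub_add_cancel]
        _ ≤ _ := abs_add_le _ _
        _ ≤ K2 * xnorm p ^ 2 + K3 * Nrm a p ^ 2 := add_le_add (hH i j) (hT i j)
        _ ≤ K2 * Nrm a p ^ 2 + K3 * Nrm a p ^ 2 := by gcongr
        _ = _ := by ring
    calc _ ≤ _ := abs_sub_add_bound _ _
      _ ≤ _ := add_le_add (hdiv _ _ h1) (hGG i j)
      _ ≤ (K2 + K3) * Nrm a p ^ 2 / Nrm a p ^ 3 + K1 ^ 2 * Nrm a p ^ 2 / Nrm a p ^ 3 := by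
          gcongr
      _ = (K2 + K3 + K1 ^ 2) / Nrm a p * 1 := by
          field_simp
      _ ≤ _ := by
          gcongr
          linarith
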